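/- Pointer state selection: under the non-degeneracy assumption (for all $\alpha \ne \beta$ there is $i$ with $p(i|\alpha) \ne p(i|\beta)$), there exists a random variable $\Upsilon$ with values in $\mathcal{P}$ such that almost surely $q_\Upsilon(n) \to 1$ (equivalently $\rho_n \to \ket{\Upsilon}\bra{\Upsilon}$), and $\mathbb{P}(\Upsilon = \alpha) = q_\alpha(0)$ for each $\alpha$. -/

import Mathlib

open Matrix MeasureTheory Filter
open scoped BigOperators ComplexOrder Topology ENNReal

/-- The imperfect-measurement Kraus map `Φ_i(ρ) = ∑_j η_{ij} V_j ρ V_j†`. -/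
noncomputable def Phi {d : ℕ} {Y : Type*} [Fintype Y]
    (η : Y → Y → ℝ) (V : Y → Matrix (Fin d) (Fin d) ℂ) (i : Y)
    (ρ : Matrix (Fin d) (Fin d) ℂ) : Matrix (Fin d) (Fin d) ℂ :=
  ∑ j, (η i j : ℂ) • (V j * ρ * (V j)ᴴ)

/-- The rank-one projector `|α⟩⟨α|` onto the pointer vector `v α`. -/
def proj {d : ℕ} {P : Type*} (v : P → (Fin d → ℂ)) (α : P) :
    Matrix (Fin d) (Fin d) ℂ :=
  Matrix.vecMulVec (v α) (star (v α))

/-- The quantum trajectory `ρ_{n+1} = Φ_{ω_n}(ρ_n)/tr(Φ_{ω_n}(ρ_n))` starting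
from `ρ0`, along the outcome sequence `ω`. -/
noncomputable def traj {d : ℕ} {Y : Type*} [Fintype Y]
    (η : Y → Y → ℝ) (V : Y → Matrix (Fin d) (Fin d) ℂ)
    (ρ0 : Matrix (Fin d) (Fin d) ℂ) : ℕ → (ℕ → Y) → Matrix (Fin d) (Fin d) ℂ
  | 0, _ => ρ0
  | n + 1, ω =>
      ((Phi η V (ω n) (traj η V ρ0 n ω)).trace)⁻¹ • Phi η V (ω n) (traj η V ρ0 n ω)

/-- The unnormalized evolution of `ρ0` along a finite word of outcomes. -/
noncomputable def evolve {d : ℕ} {Y : Type*} [Fintype Y]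
    (η : Y → Y → ℝ) (V : Y → Matrix (Fin d) (Fin d) ℂ)
    (ρ0 : Matrix (Fin d) (Fin d) ℂ) (l : List Y) : Matrix (Fin d) (Fin d) ℂ :=
  l.foldl (fun ρ i => Phi η V i ρ) ρ0

/-- The cylinder set of outcome sequences starting with the word `w`. -/
def cyl {Y : Type*} {n : ℕ} (w : Fin n → Y) : Set (ℕ → Y) :=
  {ω | ∀ k : Fin n, ω (k : ℕ) = w k}

/-- Weight of pointer `α` along a word. -/
noncomputable def wA {Y P : Type*} (q0 : P → ℝ) (p : P → Y → ℝ) (α : P) {n : ℕ} (w : Fin n → Y) : ℝ :=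
  q0 α * ∏ k, p α (w k)

/-- Total weight of a word. -/
noncomputable def wZ {Y P : Type*} [Fintype P] (q0 : P → ℝ) (p : P → Y → ℝ) {n : ℕ} (w : Fin n → Y) : ℝ :=
  ∑ α, wA q0 p α w

/-- The first `n` outcomes. -/
def pre {Y : Type*} (n : ℕ) (ω : ℕ → Y) : Fin n → Y := fun k => ω k

/-- The posterior. -/
noncomputable def wq {Y P : Type*} [Fintype P] (q0 : P → ℝ) (p : P → Y → ℝ) (α : P) {n : ℕ} (w : Fin n → Y) : ℝ :=
  wA q0 p α w / wZ q0 p w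

lemma measurable_pre {Y : Type*} [MeasurableSpace Y] (n : ℕ) : Measurable (pre (Y := Y) n) :=
  measurable_pi_lambda _ fun k => measurable_pi_apply _

lemma measurable_comp_pre {Y E : Type*} [Finite Y] [MeasurableSpace Y] [MeasurableSingletonClass Y]
    [MeasurableSpace E] {n : ℕ} (F : (Fin n → Y) → E) : Measurable (fun ω : ℕ → Y => F (pre n ω)) :=
  (measurable_of_finite F).comp (measurable_pre n)

lemma lintegral_pre {Y : Type*} [Fintype Y] [MeasurableSpace Y] [MeasurableSingletonClass Y]
    (μ : Measure (ℕ → Y)) {n : ℕ} (F : (Fin n → Y) → ℝ≥0∞) :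
    ∫⁻ ω, F (pre n ω) ∂μ = ∑ w, F w * μ (cyl w) := by
  classical
  rw [← lintegral_map (measurable_of_finite F) (measurable_pre n), lintegral_fintype]
  refine Finset.sum_congr rfl fun w _ => ?_
  rw [Measure.map_apply (measurable_pre n) (measurableSet_singleton _)]
  congr 2
  ext ω
  simp [cyl, pre, funext_iff]

lemma ae_summable {Ω : Type*} [MeasurableSpace Ω] (μ : Measure Ω) (f : ℕ → Ω → ℝ)
    (hf : ∀ n, Measurable (f n)) (h0 : ∀ n ω, 0 ≤ f n ω) (C r : ℝ) (hr0 : 0 ≤ r) (hr1 : r < 1)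
    (hC : 0 ≤ C)
    (h : ∀ n, ∫⁻ ω, ENNReal.ofReal (f n ω) ∂μ ≤ ENNReal.ofReal (C * r ^ n)) :
    ∀ᵐ ω ∂μ, Summable fun n => f n ω := by
  have h1 : ∫⁻ ω, ∑' n, ENNReal.ofReal (f n ω) ∂μ ≠ ⊤ := by
    rw [lintegral_tsum fun n => (hf n).ennreal_ofReal.aemeasurable]
    refine ne_top_of_le_ne_top ?_ (ENNReal.tsum_le_tsum h)
    rw [← ENNReal.ofReal_tsum_of_nonneg (fun n => by positivity)
      ((summable_geometric_of_lt_one hr0 hr1).mul_left C)]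
    exact ENNReal.ofReal_ne_top
  filter_upwards [ae_lt_top (Measurable.ennreal_tsum fun n => (hf n).ennreal_ofReal) h1] with ω hω
  have := ENNReal.summable_toReal hω.ne
  simpa [ENNReal.toReal_ofReal, h0] using this

section abs
set_option linter.unusedSectionVars false
variable {Y P : Type*} [Fintype Y] [Fintype P] {q0 : P → ℝ} {p : P → Y → ℝ}

lemma wA_nonneg (hq0 : ∀ α, 0 ≤ q0 α) (hp : ∀ α i, 0 ≤ p α i) (α : P) {n : ℕ} (w : Fin n → Y) :
    0 ≤ wA q0 p α w := mul_nonneg (hq0 α) (Finset.prod_nonneg fun k _ => hp _ _)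

lemma wZ_nonneg (hq0 : ∀ α, 0 ≤ q0 α) (hp : ∀ α i, 0 ≤ p α i) {n : ℕ} (w : Fin n → Y) :
    0 ≤ wZ q0 p w := Finset.sum_nonneg fun α _ => wA_nonneg hq0 hp α w

lemma wA_le_wZ (hq0 : ∀ α, 0 ≤ q0 α) (hp : ∀ α i, 0 ≤ p α i) (α : P) {n : ℕ} (w : Fin n → Y) :
    wA q0 p α w ≤ wZ q0 p w :=
  Finset.single_le_sum (f := fun α => wA q0 p α w) (fun α _ => wA_nonneg hq0 hp α w) (Finset.mem_univ α)

lemma wq_nonneg (hq0 : ∀ α, 0 ≤ q0 α) (hp : ∀ α i, 0 ≤ p α i) (α : P) {n : ℕ} (w : Fin n → Y) :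
    0 ≤ wq q0 p α w := div_nonneg (wA_nonneg hq0 hp α w) (wZ_nonneg hq0 hp w)

lemma wq_le_one (hq0 : ∀ α, 0 ≤ q0 α) (hp : ∀ α i, 0 ≤ p α i) (α : P) {n : ℕ} (w : Fin n → Y) :
    wq q0 p α w ≤ 1 := div_le_one_of_le₀ (wA_le_wZ hq0 hp α w) (wZ_nonneg hq0 hp w)

lemma wq_mul_wZ (hq0 : ∀ α, 0 ≤ q0 α) (hp : ∀ α i, 0 ≤ p α i) (α : P) {n : ℕ} (w : Fin n → Y) :
    wq q0 p α w * wZ q0 p w = wA q0 p α w := by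
  by_cases h : wZ q0 p w = 0
  · have h1 := wA_le_wZ hq0 hp α w
    have h2 := wA_nonneg hq0 hp α w
    rw [h, mul_zero]; linarith
  · exact div_mul_cancel₀ _ h

lemma sqrt_wA (hq0 : ∀ α, 0 ≤ q0 α) (hp : ∀ α i, 0 ≤ p α i) (α β : P) {n : ℕ} (w : Fin n → Y) :
    √(wA q0 p α w * wA q0 p β w) = √(q0 α * q0 β) * ∏ k, √(p α (w k) * p β (w k)) := by
  have : wA q0 p α w * wA q0 p β w = (q0 α * q0 β) * ∏ k, (p α (w k) * p β (w k)) := by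
    simp only [wA, Finset.prod_mul_distrib]; ring
  rw [this, Real.sqrt_mul (mul_nonneg (hq0 _) (hq0 _))]
  congr 1
  rw [Real.sqrt_eq_rpow, ← Real.finsetProd_rpow _ _ (fun i _ => mul_nonneg (hp _ _) (hp _ _))]
  simp [Real.sqrt_eq_rpow]

lemma sum_sqrt_wA (hq0 : ∀ α, 0 ≤ q0 α) (hp : ∀ α i, 0 ≤ p α i) (α β : P) (n : ℕ) :
    ∑ w : Fin n → Y, √(wA q0 p α w * wA q0 p β w)
      = √(q0 α * q0 β) * (∑ i, √(p α i * p β i)) ^ n := by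
  simp only [sqrt_wA hq0 hp, ← Finset.mul_sum, Fintype.sum_pow]

lemma bhatt_lt_one (hp : ∀ α i, 0 ≤ p α i) (hp1 : ∀ α, ∑ i, p α i = 1) (α β : P)
    (h : ∃ i, p α i ≠ p β i) : ∑ i, √(p α i * p β i) < 1 := by
  obtain ⟨i, hi⟩ := h
  have key : ∀ a b : ℝ, 0 ≤ a → 0 ≤ b → √(a * b) = (a + b) / 2 - (√a - √b) ^ 2 / 2 := by
    intro a b ha hb
    rw [Real.sqrt_mul ha]
    have := Real.sq_sqrt ha
    have := Real.sq_sqrt hb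
    nlinarith
  have : ∑ i, √(p α i * p β i) < ∑ i, (p α i + p β i) / 2 := by
    refine Finset.sum_lt_sum (fun j _ => ?_) ⟨i, Finset.mem_univ _, ?_⟩
    · rw [key _ _ (hp _ _) (hp _ _)]; nlinarith [sq_nonneg (√(p α j) - √(p β j))]
    · rw [key _ _ (hp _ _) (hp _ _)]
      have : √(p α i) - √(p β i) ≠ 0 := by
        intro h
        exact hi ((Real.sqrt_inj (hp _ _) (hp _ _)).1 (sub_eq_zero.1 h))
      have := pow_pos (abs_pos.2 this) 2
      rw [sq_abs] at this
      linarith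
  rw [← Finset.sum_div, Finset.sum_add_distrib, hp1, hp1] at this
  linarith

lemma sqrt_wq (hq0 : ∀ α, 0 ≤ q0 α) (hp : ∀ α i, 0 ≤ p α i) (α β : P) {n : ℕ} (w : Fin n → Y) :
    √(wq q0 p α w * wq q0 p β w) * wZ q0 p w = √(wA q0 p α w * wA q0 p β w) := by
  rw [← wq_mul_wZ hq0 hp α w, ← wq_mul_wZ hq0 hp β w]
  rw [show wq q0 p α w * wZ q0 p w * (wq q0 p β w * wZ q0 p w)
    = (wq q0 p α w * wq q0 p β w) * wZ q0 p w ^ 2 by ring,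
    Real.sqrt_mul (mul_nonneg (wq_nonneg hq0 hp _ _) (wq_nonneg hq0 hp _ _)),
    Real.sqrt_sq (wZ_nonneg hq0 hp w)]

lemma wA_succ (α : P) {n : ℕ} (w : Fin (n + 1) → Y) :
    wA q0 p α w = wA q0 p α (fun k : Fin n => w k.castSucc) * p α (w (Fin.last n)) := by
  simp [wA, Fin.prod_univ_castSucc, mul_assoc]

lemma p_le_one (hp : ∀ α i, 0 ≤ p α i) (hp1 : ∀ α, ∑ i, p α i = 1) (α : P) (i : Y) : p α i ≤ 1 := by
  rw [← hp1 α]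
  exact Finset.single_le_sum (f := p α) (fun j _ => hp _ _) (Finset.mem_univ i)

lemma incr_bound (hq0 : ∀ α, 0 ≤ q0 α) (hp : ∀ α i, 0 ≤ p α i) (hp1 : ∀ α, ∑ i, p α i = 1)
    [DecidableEq P] (α : P) {n : ℕ} (w : Fin (n + 1) → Y) :
    |wq q0 p α w - wq q0 p α (fun k : Fin n => w k.castSucc)| * wZ q0 p w ≤
      ∑ β ∈ Finset.univ.erase α, √(wA q0 p α (fun k : Fin n => w k.castSucc) *
        wA q0 p β (fun k : Fin n => w k.castSucc)) := by
  set u : Fin n → Y := fun k : Fin n => w k.castSucc with hu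
  set i := w (Fin.last n)
  have hZ : wZ q0 p w = ∑ β, wA q0 p β u * p β i := by
    simp only [wZ, wA_succ _ w]; rfl
  have hA : wA q0 p α w = wA q0 p α u * p α i := wA_succ _ w
  have e : wZ q0 p u * p α i - ∑ β, wA q0 p β u * p β i
      = ∑ β ∈ Finset.univ.erase α, wA q0 p β u * (p α i - p β i) := by
    rw [Finset.sum_erase _ (by simp), wZ, Finset.sum_mul, ← Finset.sum_sub_distrib]
    exact Finset.sum_congr rfl fun β _ => by ring
  have e2 : (wq q0 p α w - wq q0 p α u) * wZ q0 p w
      = wq q0 p α u * (wZ q0 p u * p α i - ∑ β, wA q0 p β u * p β i) := by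
    rw [sub_mul, wq_mul_wZ hq0 hp, hA, ← wq_mul_wZ hq0 hp α u, hZ]; ring
  have e3 : |wq q0 p α w - wq q0 p α u| * wZ q0 p w
      = |(wq q0 p α w - wq q0 p α u) * wZ q0 p w| := by
    rw [abs_mul, abs_of_nonneg (wZ_nonneg hq0 hp w)]
  rw [e3, e2, e, Finset.mul_sum]
  refine (Finset.abs_sum_le_sum_abs _ _).trans (Finset.sum_le_sum fun β _ => ?_)
  rw [← sqrt_wq hq0 hp, abs_mul, abs_mul, abs_of_nonneg (wq_nonneg hq0 hp _ _),
    abs_of_nonneg (wA_nonneg hq0 hp _ _), ← wq_mul_wZ hq0 hp β]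
  have h1 : |p α i - p β i| ≤ 1 := by
    have := hp α i
    have := hp β i
    have := p_le_one hp hp1 α i
    have := p_le_one hp hp1 β i
    rw [abs_le]; constructor <;> linarith
  have ha0 := wq_nonneg hq0 hp α u
  have hb0 := wq_nonneg hq0 hp β u
  have ha1 := wq_le_one hq0 hp α u
  have hb1 := wq_le_one hq0 hp β u
  have hz := wZ_nonneg hq0 hp u
  have hab : wq q0 p α u * wq q0 p β u ≤ √(wq q0 p α u * wq q0 p β u) := by
    apply Real.le_sqrt_of_sq_le
    have : wq q0 p α u * wq q0 p β u ≤ 1 := by nlinarith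
    nlinarith [mul_nonneg ha0 hb0]
  calc wq q0 p α u * (wq q0 p β u * wZ q0 p u * |p α i - p β i|)
      ≤ wq q0 p α u * (wq q0 p β u * wZ q0 p u * 1) := by gcongr
    _ = (wq q0 p α u * wq q0 p β u) * wZ q0 p u := by ring
    _ ≤ _ := by gcongr

lemma sum_castSucc {n : ℕ} (f : (Fin n → Y) → ℝ) :
    ∑ w : Fin (n + 1) → Y, f (fun k : Fin n => w k.castSucc) = Fintype.card Y * ∑ w, f w := by
  rw [← Equiv.sum_comp (Fin.snocEquiv fun _ => Y), Fintype.sum_prod_type]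
  simp [Fin.snocEquiv]

variable [MeasurableSpace Y] [MeasurableSingletonClass Y] {μ : Measure (ℕ → Y)}

lemma lint_le (h_law : ∀ (n : ℕ) (w : Fin n → Y), μ (cyl w) = ENNReal.ofReal (wZ q0 p w))
    {n : ℕ} (F : (Fin n → Y) → ℝ) (hF : ∀ w, 0 ≤ F w) (hZ : ∀ w : Fin n → Y, 0 ≤ wZ q0 p w) :
    ∫⁻ ω, ENNReal.ofReal (F (pre n ω)) ∂μ = ENNReal.ofReal (∑ w, F w * wZ q0 p w) := by
  rw [lintegral_pre μ fun w => ENNReal.ofReal (F w),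
    ENNReal.ofReal_sum_of_nonneg fun w _ => mul_nonneg (hF w) (hZ w)]
  exact Finset.sum_congr rfl fun w _ => by rw [h_law, ENNReal.ofReal_mul (hF w)]

theorem abs_main [IsProbabilityMeasure μ] [MeasurableSpace P] [MeasurableSingletonClass P]
    (hq0 : ∀ α, 0 ≤ q0 α) (hq1 : ∑ α, q0 α = 1)
    (hp : ∀ α i, 0 ≤ p α i) (hp1 : ∀ α, ∑ i, p α i = 1)
    (hnd : ∀ α β, α ≠ β → ∃ i, p α i ≠ p β i)
    (h_law : ∀ (n : ℕ) (w : Fin n → Y), μ (cyl w) = ENNReal.ofReal (wZ q0 p w)) :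
    ∃ Υ : (ℕ → Y) → P, Measurable Υ ∧
      (∀ᵐ ω ∂μ, ∀ β, Tendsto (fun n => wq q0 p β (pre n ω)) atTop
        (𝓝 (open Classical in if β = Υ ω then 1 else 0))) ∧
      (∀ᵐ ω ∂μ, ∀ n, wZ q0 p (pre n ω) ≠ 0) ∧
      (∀ α, μ {ω | Υ ω = α} = ENNReal.ofReal (q0 α)) := by
  classical
  have hne : Nonempty P := by
    by_contra h
    rw [not_nonempty_iff] at h
    simp at hq1
  have hZ0 : ∀ᵐ ω ∂μ, ∀ n, wZ q0 p (pre n ω) ≠ 0 := by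
    rw [ae_all_iff]
    intro n
    have h := lintegral_pre μ (n := n) (fun w => if wZ q0 p w = 0 then 1 else 0)
    have h0 : ∑ w : Fin n → Y, (if wZ q0 p w = 0 then (1 : ℝ≥0∞) else 0) * μ (cyl w) = 0 := by
      refine Finset.sum_eq_zero fun w _ => ?_
      split_ifs with hw
      · simp [h_law, hw]
      · simp
    rw [h0, lintegral_eq_zero_iff
      (measurable_comp_pre (fun w : Fin n → Y => if wZ q0 p w = 0 then (1 : ℝ≥0∞) else 0))] at h
    filter_upwards [h] with ω hω hz
    simp [hz] at hω
  have hr0 : ∀ α β, 0 ≤ ∑ i, √(p α i * p β i) := fun α β =>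
    Finset.sum_nonneg fun i _ => Real.sqrt_nonneg _
  have hprod : ∀ᵐ ω ∂μ, ∀ α β, α ≠ β →
      Tendsto (fun n => √(wq q0 p α (pre n ω) * wq q0 p β (pre n ω))) atTop (𝓝 0) := by
    simp only [ae_all_iff]
    intro α β hab
    have := ae_summable μ (fun n ω => √(wq q0 p α (pre n ω) * wq q0 p β (pre n ω)))
      (fun n => measurable_comp_pre (fun w : Fin n → Y => √(wq q0 p α w * wq q0 p β w)))
      (fun _ _ => Real.sqrt_nonneg _) (√(q0 α * q0 β)) (∑ i, √(p α i * p β i)) (hr0 α β)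
      (bhatt_lt_one hp hp1 α β (hnd α β hab)) (Real.sqrt_nonneg _) (fun n => by
        rw [lint_le h_law (fun w : Fin n → Y => √(wq q0 p α w * wq q0 p β w))
          (fun _ => Real.sqrt_nonneg _) (fun w => wZ_nonneg hq0 hp w)]
        simp only [sqrt_wq hq0 hp, sum_sqrt_wA hq0 hp]
        exact le_rfl)
    filter_upwards [this] with ω hω
    exact hω.tendsto_atTop_zero
  have hconv : ∀ᵐ ω ∂μ, ∀ α, ∃ L, Tendsto (fun n => wq q0 p α (pre n ω)) atTop (𝓝 L) := by
    rw [ae_all_iff]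
    intro α
    -- a common rate
    obtain ⟨r, hr0', hr1, hr⟩ : ∃ r : ℝ, 0 ≤ r ∧ r < 1 ∧
        ∀ β ∈ Finset.univ.erase α, ∑ i, √(p α i * p β i) ≤ r := by
      rcases (Finset.univ.erase α).eq_empty_or_nonempty with h | h
      · exact ⟨0, le_rfl, one_pos, by simp [h]⟩
      · obtain ⟨b, hb, hmax⟩ := Finset.exists_max_image _ (fun β => ∑ i, √(p α i * p β i)) h
        exact ⟨_, hr0 α b, bhatt_lt_one hp hp1 α b (hnd α b (Finset.ne_of_mem_erase hb).symm), hmax⟩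
    have := ae_summable μ (fun n ω => |wq q0 p α (pre (n + 1) ω) - wq q0 p α (pre n ω)|)
      (fun n => measurable_comp_pre (fun w : Fin (n + 1) → Y =>
        |wq q0 p α w - wq q0 p α (fun k : Fin n => w k.castSucc)|))
      (fun _ _ => abs_nonneg _)
      (Fintype.card Y * ∑ β ∈ Finset.univ.erase α, √(q0 α * q0 β)) r hr0' hr1
      (by positivity)
      (fun n => by
        refine (lint_le h_law (fun w : Fin (n + 1) → Y =>
          |wq q0 p α w - wq q0 p α (fun k : Fin n => w k.castSucc)|)
          (fun _ => abs_nonneg _) (fun w => wZ_nonneg hq0 hp w)).trans_le ?_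
        refine ENNReal.ofReal_le_ofReal ?_
        refine (Finset.sum_le_sum fun w _ => incr_bound hq0 hp hp1 α w).trans ?_
        rw [sum_castSucc (fun u => ∑ β ∈ Finset.univ.erase α, √(wA q0 p α u * wA q0 p β u)),
          Finset.sum_comm, mul_assoc, Finset.sum_mul]
        gcongr with β hβ
        rw [sum_sqrt_wA hq0 hp]
        have := hr β hβ
        have := hr0 α β
        gcongr)
    filter_upwards [this] with ω hω
    apply cauchySeq_tendsto_of_complete
    apply cauchySeq_of_summable_dist
    simpa [dist_comm, Real.dist_eq, abs_sub_comm] using hω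
  -- selection
  let S : P → Set (ℕ → Y) := fun α => {ω | Tendsto (fun n => wq q0 p α (pre n ω)) atTop (𝓝 1)}
  have hS : ∀ α, MeasurableSet (S α) := fun α =>
    measurableSet_tendsto (𝓝 1) fun n => measurable_comp_pre (fun w : Fin n → Y => wq q0 p α w)
  let g : (P → Prop) → P := fun s => if h : ∃ α, s α then h.choose else hne.some
  let Υ : (ℕ → Y) → P := fun ω => g fun α => ω ∈ S α
  have hΥ : Measurable Υ := by
    refine (measurable_of_finite g).comp (measurable_pi_lambda _ fun α => ?_)
    exact measurableSet_setOfPred.1 (hS α)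
  have hlim : ∀ᵐ ω ∂μ, ∀ β, Tendsto (fun n => wq q0 p β (pre n ω)) atTop
        (𝓝 (if β = Υ ω then 1 else 0)) := by
    filter_upwards [hZ0, hprod, hconv] with ω hz hpr hc
    choose L hL using hc
    have hsum : ∑ α, L α = 1 := by
      have h1 := tendsto_finsetSum Finset.univ fun α _ => hL α
      refine tendsto_nhds_unique h1 ?_
      have : ∀ n, ∑ α, wq q0 p α (pre n ω) = 1 := fun n => by
        simp only [wq, ← Finset.sum_div]
        exact div_self (hz n)
      simp [this]
    have hL0 : ∀ α β, α ≠ β → L α = 0 ∨ L β = 0 := fun α β hab => by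
      have h1 := ((hL α).mul (hL β)).sqrt
      have h2 := tendsto_nhds_unique h1 (hpr α β hab)
      have h3 : 0 ≤ L α := ge_of_tendsto' (hL α) fun n => wq_nonneg hq0 hp _ _
      have h4 : 0 ≤ L β := ge_of_tendsto' (hL β) fun n => wq_nonneg hq0 hp _ _
      rw [Real.sqrt_eq_zero (mul_nonneg h3 h4)] at h2
      exact mul_eq_zero.1 h2
    obtain ⟨a, ha⟩ : ∃ a, L a ≠ 0 := by
      by_contra! h
      simp [h] at hsum
    have hb : ∀ β, β ≠ a → L β = 0 := fun β hβ => (hL0 β a hβ).resolve_right ha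
    have ha1 : L a = 1 := by
      rw [← hsum]
      exact (Finset.sum_eq_single a (fun b _ h => hb b h) (by simp)).symm
    have hex : ∃ α, ω ∈ S α := ⟨a, show Tendsto _ _ (𝓝 1) from ha1 ▸ hL a⟩
    have hΥa : Υ ω = a := by
      have h1 : Υ ω = hex.choose := dif_pos hex
      have h2 : Tendsto (fun n => wq q0 p (Υ ω) (pre n ω)) atTop (𝓝 1) := by
        rw [h1]; exact hex.choose_spec
      by_contra hne'
      have := tendsto_nhds_unique h2 (hL _)
      rw [hb _ hne'] at this
      exact one_ne_zero this
    intro β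
    rw [hΥa]
    split_ifs with h
    · rw [h, ← ha1]; exact hL a
    · rw [← hb β h]; exact hL β
  refine ⟨Υ, hΥ, ?_, hZ0, ?_⟩
  · filter_upwards [hlim] with ω h β
    convert h β
  intro α
  have hmean : ∀ n, ∫⁻ ω, ENNReal.ofReal (wq q0 p α (pre n ω)) ∂μ = ENNReal.ofReal (q0 α) := by
    intro n
    rw [lint_le h_law (fun w : Fin n → Y => wq q0 p α w) (fun w => wq_nonneg hq0 hp _ _)
      (fun w => wZ_nonneg hq0 hp w)]
    simp only [wq_mul_wZ hq0 hp]
    simp only [wA, ← Finset.mul_sum, ← Fintype.sum_pow, hp1, one_pow, mul_one]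
  have hset : MeasurableSet {ω | Υ ω = α} := hΥ (measurableSet_singleton α)
  have hT := tendsto_lintegral_of_dominated_convergence (μ := μ)
    (F := fun n ω => ENNReal.ofReal (wq q0 p α (pre n ω)))
    (f := fun ω => Set.indicator {ω | Υ ω = α} 1 ω) (fun _ => 1)
    (fun n => measurable_comp_pre (fun w : Fin n → Y => ENNReal.ofReal (wq q0 p α w)))
    (fun n => Eventually.of_forall fun ω => by
      simpa using wq_le_one hq0 hp α (pre n ω))
    (by simp)
    (by
      filter_upwards [hlim] with ω h
      have := (ENNReal.continuous_ofReal.tendsto _).comp (h α)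
      have e : Set.indicator {ω | Υ ω = α} (1 : (ℕ → Y) → ℝ≥0∞) ω
          = ENNReal.ofReal (if α = Υ ω then 1 else 0) := by
        by_cases h' : α = Υ ω
        · simp [h'.symm]
        · simp [h', Ne.symm h']
      rw [e]
      exact this)
  simp only [hmean] at hT
  rw [lintegral_indicator_one hset] at hT
  exact (tendsto_nhds_unique tendsto_const_nhds hT).symm
end abs

/-- Matrix coefficients in the pointer basis. -/
def bm {d : ℕ} {P : Type*} (v : P → (Fin d → ℂ)) (ρ : Matrix (Fin d) (Fin d) ℂ) (α β : P) : ℂ :=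
  star (v α) ⬝ᵥ (ρ *ᵥ v β)

/-- Outcome probabilities. -/
noncomputable def pp {Y P : Type*} [Fintype Y] (η : Y → Y → ℝ) (c : Y → P → ℂ) (α : P) (i : Y) : ℝ :=
  ∑ j, η i j * Complex.normSq (c j α)

section mat
set_option linter.unusedSectionVars false
variable {d : ℕ} {Y P : Type*} [Fintype Y] [Fintype P] [DecidableEq P]
    {η : Y → Y → ℝ} {V : Y → Matrix (Fin d) (Fin d) ℂ}
    {v : P → (Fin d → ℂ)} {c : Y → P → ℂ}

lemma trace_proj_mul (ρ : Matrix (Fin d) (Fin d) ℂ) (α : P) :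
    (proj v α * ρ).trace = bm v ρ α α := by
  rw [proj, Matrix.vecMulVec_mul, Matrix.trace_vecMulVec, dotProduct_comm, bm,
    Matrix.dotProduct_mulVec]

lemma trace_eq_sum (h_complete : ∑ α, proj v α = 1) (ρ : Matrix (Fin d) (Fin d) ℂ) :
    ρ.trace = ∑ α, bm v ρ α α := by
  simp only [← trace_proj_mul]
  rw [← Matrix.trace_sum, ← Finset.sum_mul, h_complete, one_mul]

lemma proj_mulVec (h_orth : ∀ α β, star (v α) ⬝ᵥ v β = if α = β then 1 else 0) (α β : P) :
    proj v α *ᵥ v β = if α = β then v β else 0 := by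
  rw [proj, Matrix.vecMulVec_mulVec, h_orth]
  split_ifs with h <;> simp [h]

lemma proj_conjTranspose (α : P) : (proj v α)ᴴ = proj v α := by
  simp [proj, Matrix.conjTranspose_vecMulVec]

lemma V_mulVec (h_orth : ∀ α β, star (v α) ⬝ᵥ v β = if α = β then 1 else 0)
    (h_diag : ∀ j, V j = ∑ α, c j α • proj v α) (j : Y) (β : P) :
    V j *ᵥ v β = c j β • v β := by
  rw [h_diag, Matrix.sum_mulVec]
  simp [Matrix.smul_mulVec, proj_mulVec h_orth]

lemma VH_mulVec (h_orth : ∀ α β, star (v α) ⬝ᵥ v β = if α = β then 1 else 0)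
    (h_diag : ∀ j, V j = ∑ α, c j α • proj v α) (j : Y) (β : P) :
    (V j)ᴴ *ᵥ v β = star (c j β) • v β := by
  rw [h_diag, Matrix.conjTranspose_sum, Matrix.sum_mulVec]
  simp [Matrix.conjTranspose_smul, proj_conjTranspose, Matrix.smul_mulVec, proj_mulVec h_orth]

lemma bm_conj (h_orth : ∀ α β, star (v α) ⬝ᵥ v β = if α = β then 1 else 0)
    (h_diag : ∀ j, V j = ∑ α, c j α • proj v α) (j : Y) (ρ : Matrix (Fin d) (Fin d) ℂ) (α : P) :
    bm v (V j * ρ * (V j)ᴴ) α α = (Complex.normSq (c j α) : ℂ) * bm v ρ α α := by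
  have h1 : star (v α) ᵥ* V j = c j α • star (v α) := by
    have := congrArg star (VH_mulVec h_orth h_diag j α)
    rw [Matrix.star_mulVec, Matrix.conjTranspose_conjTranspose] at this
    simpa using this
  rw [bm, ← Matrix.mulVec_mulVec, ← Matrix.mulVec_mulVec, VH_mulVec h_orth h_diag,
    Matrix.dotProduct_mulVec, h1, Matrix.mulVec_smul, bm, smul_dotProduct, dotProduct_smul,
    ← Complex.mul_conj]
  simp only [smul_eq_mul, Complex.star_def]
  ring

lemma bm_smul (z : ℂ) (ρ : Matrix (Fin d) (Fin d) ℂ) (α β : P) :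
    bm v (z • ρ) α β = z * bm v ρ α β := by
  simp [bm, Matrix.smul_mulVec]

lemma bm_Phi (h_orth : ∀ α β, star (v α) ⬝ᵥ v β = if α = β then 1 else 0)
    (h_diag : ∀ j, V j = ∑ α, c j α • proj v α) (i : Y) (ρ : Matrix (Fin d) (Fin d) ℂ) (α : P) :
    bm v (Phi η V i ρ) α α = (pp η c α i : ℂ) * bm v ρ α α := by
  have : bm v (Phi η V i ρ) α α = ∑ j, bm v ((η i j : ℂ) • (V j * ρ * (V j)ᴴ)) α α := by
    simp only [bm, Phi, Matrix.sum_mulVec, dotProduct_sum]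
  rw [this]
  simp only [bm_smul, bm_conj h_orth h_diag, pp]
  push_cast
  rw [Finset.sum_mul]
  exact Finset.sum_congr rfl fun j _ => by ring

lemma bm_proj (h_orth : ∀ α β, star (v α) ⬝ᵥ v β = if α = β then 1 else 0) (α β : P) :
    bm v (proj v α) β β = if β = α then 1 else 0 := by
  rw [bm, proj_mulVec h_orth]
  by_cases h : α = β
  · subst h; simp [h_orth]
  · simp [h, Ne.symm h]

lemma trace_Phi_proj (h_orth : ∀ α β, star (v α) ⬝ᵥ v β = if α = β then 1 else 0)
    (h_complete : ∑ α, proj v α = 1)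
    (h_diag : ∀ j, V j = ∑ α, c j α • proj v α) (i : Y) (α : P) :
    (Phi η V i (proj v α)).trace = (pp η c α i : ℂ) := by
  rw [trace_eq_sum h_complete]
  simp [bm_Phi h_orth h_diag, bm_proj h_orth]

lemma pp_sum (hV : ∑ j, (V j)ᴴ * V j = 1) (hη_sum : ∀ j, ∑ i, η i j = 1)
    (h_orth : ∀ α β, star (v α) ⬝ᵥ v β = if α = β then 1 else 0)
    (h_diag : ∀ j, V j = ∑ α, c j α • proj v α) (α : P) : ∑ i, pp η c α i = 1 := by
  have h1 : ∑ i, pp η c α i = ∑ j, Complex.normSq (c j α) := by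
    simp only [pp]
    rw [Finset.sum_comm]
    simp [← Finset.sum_mul, hη_sum]
  have h2 : star (v α) ⬝ᵥ ((∑ j, (V j)ᴴ * V j) *ᵥ v α) = ∑ j, (Complex.normSq (c j α) : ℂ) := by
    rw [Matrix.sum_mulVec, dotProduct_sum]
    refine Finset.sum_congr rfl fun j _ => ?_
    rw [← Matrix.mulVec_mulVec, V_mulVec h_orth h_diag, Matrix.mulVec_smul, VH_mulVec h_orth h_diag,
      dotProduct_smul, dotProduct_smul, h_orth, ← Complex.mul_conj]
    simp
  rw [hV, Matrix.one_mulVec, h_orth, if_pos rfl] at h2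
  rw [h1]
  exact_mod_cast h2.symm

lemma evolve_succ (ρ0 : Matrix (Fin d) (Fin d) ℂ) {n : ℕ} (w : Fin (n + 1) → Y) :
    evolve η V ρ0 (List.ofFn w) =
      Phi η V (w (Fin.last n)) (evolve η V ρ0 (List.ofFn fun k : Fin n => w k.castSucc)) := by
  rw [List.ofFn_succ', evolve, List.concat_eq_append, List.foldl_append]
  rfl

lemma bm_evolve (h_orth : ∀ α β, star (v α) ⬝ᵥ v β = if α = β then 1 else 0)
    (h_diag : ∀ j, V j = ∑ α, c j α • proj v α) (ρ0 : Matrix (Fin d) (Fin d) ℂ) (q0 : P → ℝ)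
    (hq : ∀ α, bm v ρ0 α α = q0 α) {n : ℕ} (w : Fin n → Y) (α : P) :
    bm v (evolve η V ρ0 (List.ofFn w)) α α = (wA q0 (pp η c) α w : ℂ) := by
  induction n with
  | zero => simp [evolve, wA, hq]
  | succ n ih =>
    rw [evolve_succ, bm_Phi h_orth h_diag, ih, wA_succ]
    push_cast; ring

lemma trace_evolve (h_orth : ∀ α β, star (v α) ⬝ᵥ v β = if α = β then 1 else 0)
    (h_complete : ∑ α, proj v α = 1)
    (h_diag : ∀ j, V j = ∑ α, c j α • proj v α) (ρ0 : Matrix (Fin d) (Fin d) ℂ) (q0 : P → ℝ)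
    (hq : ∀ α, bm v ρ0 α α = q0 α) {n : ℕ} (w : Fin n → Y) :
    (evolve η V ρ0 (List.ofFn w)).trace = (wZ q0 (pp η c) w : ℂ) := by
  rw [trace_eq_sum h_complete, wZ]
  push_cast
  exact Finset.sum_congr rfl fun α _ => bm_evolve h_orth h_diag ρ0 q0 hq w α

lemma Phi_psd (hη_nonneg : ∀ i j, 0 ≤ η i j) (i : Y) {ρ : Matrix (Fin d) (Fin d) ℂ}
    (h : ρ.PosSemidef) : (Phi η V i ρ).PosSemidef := by
  refine Matrix.posSemidef_sum _ fun j _ => ?_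
  exact (h.mul_mul_conjTranspose_same (V j)).smul (by exact_mod_cast hη_nonneg i j)

lemma Phi_smul (i : Y) (z : ℂ) (ρ : Matrix (Fin d) (Fin d) ℂ) :
    Phi η V i (z • ρ) = z • Phi η V i ρ := by
  simp only [Phi, Finset.smul_sum, Matrix.mul_smul, Matrix.smul_mul]
  exact Finset.sum_congr rfl fun j _ => smul_comm _ _ _

lemma traj_psd (hη_nonneg : ∀ i j, 0 ≤ η i j) {ρ0 : Matrix (Fin d) (Fin d) ℂ}
    (h : ρ0.PosSemidef) (n : ℕ) (ω : ℕ → Y) : (traj η V ρ0 n ω).PosSemidef := by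
  induction n with
  | zero => exact h
  | succ n ih =>
    have := Phi_psd (V := V) hη_nonneg (ω n) ih
    exact this.smul (inv_nonneg_of_nonneg this.trace_nonneg)

lemma traj_eq (ρ0 : Matrix (Fin d) (Fin d) ℂ) (htr : ρ0.trace = 1) (ω : ℕ → Y)
    (hz : ∀ n, (evolve η V ρ0 (List.ofFn (pre n ω))).trace ≠ 0) (n : ℕ) :
    traj η V ρ0 n ω = ((evolve η V ρ0 (List.ofFn (pre n ω))).trace)⁻¹ •
      evolve η V ρ0 (List.ofFn (pre n ω)) := by
  induction n with
  | zero => simp [traj, evolve, htr]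
  | succ n ih =>
    have e : evolve η V ρ0 (List.ofFn (pre (n + 1) ω)) =
      Phi η V (ω n) (evolve η V ρ0 (List.ofFn (pre n ω))) := evolve_succ ρ0 _
    rw [traj, ih, Phi_smul, Matrix.trace_smul, e, smul_smul, smul_eq_mul, mul_inv, inv_inv,
      mul_right_comm, mul_inv_cancel₀ (hz n), one_mul]

lemma matrix_expand (h_complete : ∑ α, proj v α = 1) (ρ : Matrix (Fin d) (Fin d) ℂ) :
    ρ = ∑ α, ∑ β, bm v ρ α β • Matrix.vecMulVec (v α) (star (v β)) := by
  have : ρ = (∑ α, proj v α) * ρ * (∑ β, proj v β) := by rw [h_complete]; simp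
  conv_lhs => rw [this]
  simp only [Finset.sum_mul, Finset.mul_sum]
  rw [Finset.sum_comm]
  refine Finset.sum_congr rfl fun α _ => Finset.sum_congr rfl fun β _ => ?_
  rw [proj, proj, Matrix.vecMulVec_mul, Matrix.vecMulVec_mul_vecMulVec, ← Matrix.dotProduct_mulVec,
    Matrix.vecMulVec_smul]
  rfl

lemma bm_add_bound {ρ : Matrix (Fin d) (Fin d) ℂ} (h : ρ.PosSemidef) (α β : P)
    (hb : (bm v ρ β β).re ≤ 1) : ‖bm v ρ α β‖ ^ 2 ≤ (bm v ρ α α).re := by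
  set z := bm v ρ α β with hz
  have hzs : bm v ρ β α = star z := by
    rw [hz, bm, bm, Matrix.star_dotProduct, Matrix.star_mulVec, h.1.eq,
      ← Matrix.dotProduct_mulVec]
  have h1 := h.re_dotProduct_nonneg (v α - star z • v β)
  have h2 : star (v α - star z • v β) ⬝ᵥ (ρ *ᵥ (v α - star z • v β))
      = bm v ρ α α - star z * z - z * star z + z * star z * bm v ρ β β := by
    rw [Matrix.mulVec_sub, Matrix.mulVec_smul, star_sub, star_smul, star_star, sub_dotProduct,
      dotProduct_sub, dotProduct_sub, smul_dotProduct, smul_dotProduct, dotProduct_smul,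
      dotProduct_smul]
    change bm v ρ α α - star z * bm v ρ α β - (z * bm v ρ β α - z * (star z * bm v ρ β β)) = _
    rw [hzs, ← hz]; ring
  have h3 : z * star z = ((‖z‖ ^ 2 : ℝ) : ℂ) := by
    rw [Complex.star_def, Complex.mul_conj, Complex.normSq_eq_norm_sq]
  rw [h2, mul_comm (star z) z, h3] at h1
  simp only [RCLike.re_eq_complex_re, Complex.add_re, Complex.sub_re, Complex.re_ofReal_mul,
    Complex.ofReal_re] at h1
  nlinarith [sq_nonneg ‖z‖]

end mat

/-- pointer state selection. Under the non-degeneracy assumption,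
there is a random pointer state `Υ` such that almost surely `q_Υ(n) → 1`
(equivalently `ρ_n → |Υ⟩⟨Υ|`), and `ℙ(Υ = α) = q_α(0)` for each `α`. -/
theorem stmt13 {d : ℕ} {Y P : Type*} [Fintype Y] [Fintype P] [DecidableEq P]
    [MeasurableSpace Y] [MeasurableSingletonClass Y]
    [MeasurableSpace P] [MeasurableSingletonClass P]
    (η : Y → Y → ℝ) (V : Y → Matrix (Fin d) (Fin d) ℂ)
    (v : P → (Fin d → ℂ)) (c : Y → P → ℂ)
    (hV : ∑ j, (V j)ᴴ * V j = 1)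
    (hη_nonneg : ∀ i j, 0 ≤ η i j) (hη_sum : ∀ j, ∑ i, η i j = 1)
    (h_orth : ∀ α β, star (v α) ⬝ᵥ v β = if α = β then 1 else 0)
    (h_complete : ∑ α, proj v α = 1)
    (h_diag : ∀ j, V j = ∑ α, c j α • proj v α)
    (h_nondeg : ∀ α β, α ≠ β →
      ∃ i, (Phi η V i (proj v α)).trace ≠ (Phi η V i (proj v β)).trace)
    (ρ0 : Matrix (Fin d) (Fin d) ℂ) (hρ0 : ρ0.PosSemidef) (hρ0tr : ρ0.trace = 1)
    (μ : Measure (ℕ → Y)) [IsProbabilityMeasure μ]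
    (h_law : ∀ (n : ℕ) (w : Fin n → Y),
      μ (cyl w) = ENNReal.ofReal ((evolve η V ρ0 (List.ofFn w)).trace.re)) :
    ∃ Υ : (ℕ → Y) → P, Measurable Υ ∧
      (∀ᵐ ω ∂μ,
        Tendsto (fun n => (proj v (Υ ω) * traj η V ρ0 n ω).trace.re)
          atTop (𝓝 1)) ∧
      (∀ᵐ ω ∂μ,
        Tendsto (fun n => traj η V ρ0 n ω) atTop (𝓝 (proj v (Υ ω)))) ∧
      (∀ α, μ {ω | Υ ω = α} = ENNReal.ofReal ((proj v α * ρ0).trace.re)) := by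
  classical
  have hb0 : ∀ α, 0 ≤ bm v ρ0 α α := fun α => hρ0.dotProduct_mulVec_nonneg (v α)
  set q0 : P → ℝ := fun α => (proj v α * ρ0).trace.re with hq0def
  have hq : ∀ α, bm v ρ0 α α = (q0 α : ℂ) := fun α => by
    rw [hq0def]
    simp only [trace_proj_mul]
    exact Complex.eq_re_of_ofReal_le (r := 0) (by simpa using hb0 α)
  have hq0 : ∀ α, 0 ≤ q0 α := fun α => by
    have := hb0 α
    rw [hq] at this
    exact_mod_cast this
  have hq1 : ∑ α, q0 α = 1 := by
    have := trace_eq_sum h_complete ρ0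
    simp only [hq, hρ0tr] at this
    exact_mod_cast this.symm
  have hp : ∀ α i, 0 ≤ pp η c α i := fun α i =>
    Finset.sum_nonneg fun j _ => mul_nonneg (hη_nonneg i j) (Complex.normSq_nonneg _)
  have hp1 := pp_sum hV hη_sum h_orth h_diag
  have htrE : ∀ {n : ℕ} (w : Fin n → Y), (evolve η V ρ0 (List.ofFn w)).trace
      = (wZ q0 (pp η c) w : ℂ) := fun w => trace_evolve h_orth h_complete h_diag ρ0 q0 hq w
  obtain ⟨Υ, hΥ, hlim, hZ, hlaw⟩ := abs_main (μ := μ) hq0 hq1 hp hp1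
    (fun α β hab => by
      obtain ⟨i, hi⟩ := h_nondeg α β hab
      refine ⟨i, fun h => hi ?_⟩
      rw [trace_Phi_proj h_orth h_complete h_diag, trace_Phi_proj h_orth h_complete h_diag, h])
    (fun n w => by rw [h_law, htrE, Complex.ofReal_re])
  have hdiag : ∀ᵐ ω ∂μ, ∀ n α, bm v (traj η V ρ0 n ω) α α = (wq q0 (pp η c) α (pre n ω) : ℂ) := by
    filter_upwards [hZ] with ω hz n α
    rw [traj_eq ρ0 hρ0tr ω (fun n => by rw [htrE]; exact_mod_cast hz n), bm_smul, htrE,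
      bm_evolve h_orth h_diag ρ0 q0 hq, wq]
    push_cast
    rw [div_eq_inv_mul]
  refine ⟨Υ, hΥ, ?_, ?_, hlaw⟩
  · filter_upwards [hlim, hdiag] with ω hl hd
    simp only [trace_proj_mul, hd, Complex.ofReal_re]
    simpa using hl (Υ ω)
  · filter_upwards [hlim, hdiag] with ω hl hd
    have hbd : ∀ n α β, ‖bm v (traj η V ρ0 n ω) α β‖ ^ 2 ≤ wq q0 (pp η c) α (pre n ω) := by
      intro n α β
      have := bm_add_bound (v := v) (traj_psd (V := V) hη_nonneg hρ0 n ω) α β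
        (by rw [hd, Complex.ofReal_re]; exact wq_le_one hq0 hp _ _)
      rwa [hd n α, Complex.ofReal_re] at this
    have hsymm : ∀ n α β, ‖bm v (traj η V ρ0 n ω) α β‖ = ‖bm v (traj η V ρ0 n ω) β α‖ := by
      intro n α β
      have h := (traj_psd (V := V) hη_nonneg hρ0 n ω).1.eq
      rw [← norm_star, bm, bm, Matrix.star_dotProduct, star_star, Matrix.star_mulVec, h,
        ← Matrix.dotProduct_mulVec]
    have hoff : ∀ α β, α ≠ Υ ω →
        Tendsto (fun n => bm v (traj η V ρ0 n ω) α β) atTop (𝓝 0) := by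
      intro α β h
      have h1 := (hl α).sqrt
      rw [if_neg h, Real.sqrt_zero] at h1
      exact squeeze_zero_norm (fun n => Real.le_sqrt_of_sq_le (hbd n α β)) h1
    have hall : ∀ α β, Tendsto (fun n => bm v (traj η V ρ0 n ω) α β) atTop
        (𝓝 (if α = Υ ω ∧ β = Υ ω then 1 else 0)) := by
      intro α β
      by_cases ha : α = Υ ω
      · by_cases hb : β = Υ ω
        · rw [if_pos ⟨ha, hb⟩, ha, hb]
          simp only [hd]
          have := hl (Υ ω)
          rw [if_pos rfl] at this
          exact_mod_cast (Complex.continuous_ofReal.tendsto 1).comp this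
        · rw [if_neg (by tauto)]
          have := (hoff β α hb).norm
          rw [norm_zero] at this
          refine squeeze_zero_norm (fun n => (hsymm n α β).le) this
      · rw [if_neg (by tauto)]
        exact hoff α β ha
    have hT : Tendsto (fun n => ∑ α, ∑ β, bm v (traj η V ρ0 n ω) α β •
        Matrix.vecMulVec (v α) (star (v β))) atTop (𝓝 (∑ α, ∑ β,
          (if α = Υ ω ∧ β = Υ ω then (1 : ℂ) else 0) • Matrix.vecMulVec (v α) (star (v β)))) :=
      tendsto_finsetSum _ fun α _ => tendsto_finsetSum _ fun β _ => (hall α β).smul_const _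
    simp only [← matrix_expand h_complete] at hT
    convert hT using 2
    rw [Finset.sum_eq_single (Υ ω), Finset.sum_eq_single (Υ ω)]
    · simp [proj]
    · intro b _ hb; simp [hb]
    · simp
    · intro b _ hb; simp [hb]
    · simp
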